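/- Let X be a real normed space, C ⊆ X a subset, K > 0, e ∈ X with e ≠ 0, and v* ∈ X* a continuous linear functional with v*(e) ≠ 0 and v*(u) ≥ K‖u‖ for all u ∈ C. Define P : X → X by P(x) = (v*(x)/v*(e)) · e, and let N = ‖P‖ be its operator norm. Then for every nonzero w ∈ C one has P(w) ≠ 0 and ‖w − P(w)‖ / ‖P(w)‖ ≤ (1 + N)·|v*(e)| / (K‖e‖). -/

import Mathlib

/-- The uniform ratio bound from the proof of Theorem 2.3: for nonzero `w` in
the cone `C` on which `v*` is uniformly positive, the ratio of the complementary
component `w - P w` to the one-dimensional component `P w` is bounded above by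
`(1 + ‖P‖)·|v*(e)|/(K‖e‖)`. -/
theorem ratio_bound_on_cone {X : Type*} [NormedAddCommGroup X]
    [NormedSpace ℝ X] (C : Set X) (K : ℝ) (hK : 0 < K)
    (e : X) (he : e ≠ 0) (v : X →L[ℝ] ℝ) (hve : v e ≠ 0)
    (hv : ∀ u ∈ C, K * ‖u‖ ≤ v u)
    (P : X →L[ℝ] X) (hP : ∀ x, P x = (v x / v e) • e) :
    ∀ w ∈ C, w ≠ 0 →
      P w ≠ 0 ∧ ‖w - P w‖ / ‖P w‖ ≤ (1 + ‖P‖) * |v e| / (K * ‖e‖) := by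
  intro w hw hw0
  have hvw : 0 < v w := (mul_pos hK (norm_pos_iff.2 hw0)).trans_le (hv w hw)
  have hPw : P w ≠ 0 := by
    rw [hP]
    exact smul_ne_zero (div_ne_zero hvw.ne' hve) he
  have norm_Pw : |v e| * ‖P w‖ = v w * ‖e‖ := by
    have := abs_ne_zero.2 hve
    rw [hP, norm_smul, Real.norm_eq_abs, abs_div, abs_of_pos hvw]
    field_simp
  have norm_compl : ‖w - P w‖ ≤ (1 + ‖P‖) * ‖w‖ := by
    linarith [norm_sub_le w (P w), P.le_opNorm w]
  refine ⟨hPw, ?_⟩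
  rw [div_le_div_iff₀ (norm_pos_iff.2 hPw) (mul_pos hK (norm_pos_iff.2 he))]
  calc ‖w - P w‖ * (K * ‖e‖) ≤ (1 + ‖P‖) * ‖w‖ * (K * ‖e‖) := by gcongr
    _ = (1 + ‖P‖) * (K * ‖w‖ * ‖e‖) := by ring
    _ ≤ (1 + ‖P‖) * (v w * ‖e‖) := by
      gcongr
      exact hv w hw
    _ = (1 + ‖P‖) * |v e| * ‖P w‖ := by rw [← norm_Pw, mul_assoc]
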